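/- Let X = {7, 8, 10, 13, 17, 19, 21} ⊂ ℝ with the metric d(x,y) = |x − y|, let N_p = 2, and let C be the 2-clustering {{7, 8, 10, 13}, {17, 19, 21}}. Then C is weakly separable and LM-separable for N_p = 2, but C is not strongly separable for N_p = 2. (Hence weak separability together with LM-separability does not imply strong separability.) -/

import Mathlib

variable {α : Type*}

/-- Sparsity ε_{N_p}(x): smallest ε ≥ 0 such that at least N_p points of X lie within
distance ε of x. -/
noncomputable def sparsity [MetricSpace α] (X : Finset α) (Np : ℕ) (x : α) : ℝ :=
  sInf {ε : ℝ | 0 ≤ ε ∧ Np ≤ (X.filter (fun y => dist x y ≤ ε)).card}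

/-- x is ε-connected to y: there is a finite sequence of points of X from x to y,
each of sparsity at most ε, with consecutive distances at most ε. -/
def EpsConn [MetricSpace α] (X : Finset α) (Np : ℕ) (ε : ℝ) (x y : α) : Prop :=
  x ∈ X ∧ sparsity X Np x ≤ ε ∧
    Relation.ReflTransGen (fun a b => b ∈ X ∧ sparsity X Np b ≤ ε ∧ dist a b ≤ ε) x y

/-- A set c is ε-connected if every pair of points of c is ε-connected. -/
def SetConn [MetricSpace α] (X : Finset α) (Np : ℕ) (ε : ℝ) (c : Finset α) : Prop :=
  ∀ x ∈ c, ∀ y ∈ c, EpsConn X Np ε x y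

/-- ε*(c): the minimum ε such that c is ε-connected. -/
noncomputable def setSparsity [MetricSpace α] (X : Finset α) (Np : ℕ) (c : Finset α) : ℝ :=
  sInf {ε : ℝ | SetConn X Np ε c}

/-- ε(x,y): the minimum ε such that x is ε-connected to y. -/
noncomputable def epsDist [MetricSpace α] (X : Finset α) (Np : ℕ) (x y : α) : ℝ :=
  sInf {ε : ℝ | EpsConn X Np ε x y}

/-- ε(x,c): min over y ∈ c of ε(x,y). -/
noncomputable def ptClusterDist [MetricSpace α] (X : Finset α) (Np : ℕ) (x : α)
    (c : Finset α) : ℝ :=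
  sInf {e : ℝ | ∃ y ∈ c, e = epsDist X Np x y}

/-- ε(c,c'): min over x ∈ c, y ∈ c' of ε(x,y). -/
noncomputable def clusterDist [MetricSpace α] (X : Finset α) (Np : ℕ)
    (c c' : Finset α) : ℝ :=
  sInf {e : ℝ | ∃ x ∈ c, ∃ y ∈ c', e = epsDist X Np x y}

/-- A clustering of X: a partition of X into nonempty clusters. -/
def IsClustering (X : Finset α) (C : Finset (Finset α)) : Prop :=
  (∀ c ∈ C, c.Nonempty) ∧ (∀ c ∈ C, ∀ c' ∈ C, c ≠ c' → Disjoint c c') ∧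
    (∀ c ∈ C, c ⊆ X) ∧ (∀ x ∈ X, ∃ c ∈ C, x ∈ c)

/-- C is weakly separable: for each cluster c, ε*(c) < min over c' ≠ c of ε(c,c'). -/
def WeaklySeparable [MetricSpace α] (X : Finset α) (Np : ℕ) (C : Finset (Finset α)) : Prop :=
  ∀ c ∈ C, ∀ c' ∈ C, c' ≠ c → setSparsity X Np c < clusterDist X Np c c'

/-- c is an ε-cluster: a (nonempty) maximal ε-connected subset of X. -/
def IsEpsCluster [MetricSpace α] (X : Finset α) (Np : ℕ) (ε : ℝ) (c : Finset α) : Prop :=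
  c.Nonempty ∧ SetConn X Np ε c ∧ ∀ x ∈ X, (∃ y ∈ c, EpsConn X Np ε x y) → x ∈ c

/-- c is a maximal cluster: an ε-cluster for some ε ≥ 0. -/
def IsMaximalCluster [MetricSpace α] (X : Finset α) (Np : ℕ) (c : Finset α) : Prop :=
  ∃ ε : ℝ, 0 ≤ ε ∧ IsEpsCluster X Np ε c

/-- x is a local maximum: every y ∈ X with d(x,y) ≤ ε_{N_p}(x) has sparsity ≥ that of x. -/
def IsLocalMaxPt [MetricSpace α] (X : Finset α) (Np : ℕ) (x : α) : Prop :=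
  x ∈ X ∧ ∀ y ∈ X, dist x y ≤ sparsity X Np x → sparsity X Np x ≤ sparsity X Np y

/-- X_c*: the points of c of minimum sparsity within c. -/
noncomputable def minSparsityPts [MetricSpace α] (X : Finset α) (Np : ℕ)
    (c : Finset α) : Finset α :=
  c.filter (fun x => ∀ y ∈ c, sparsity X Np x ≤ sparsity X Np y)

/-- Relative separability A(x,y) = ε(x,y) / ε_{N_p}(x). -/
noncomputable def relSep [MetricSpace α] (X : Finset α) (Np : ℕ) (x y : α) : ℝ :=
  epsDist X Np x y / sparsity X Np x

/-- A(x,c) = min over y ∈ c of A(x,y). -/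
noncomputable def relSepCluster [MetricSpace α] (X : Finset α) (Np : ℕ) (x : α)
    (c : Finset α) : ℝ :=
  sInf {a : ℝ | ∃ y ∈ c, a = relSep X Np x y}

/-- A^ℓ(C): the minimum A such that for every local maximum x, every y in the cluster of x
with sparsity at most that of x satisfies A(x,y) ≤ A. -/
noncomputable def Aell [MetricSpace α] (X : Finset α) (Np : ℕ)
    (C : Finset (Finset α)) : ℝ :=
  sInf {A : ℝ | ∀ x ∈ X, IsLocalMaxPt X Np x → ∀ c ∈ C, x ∈ c →
    ∀ y ∈ c, sparsity X Np y ≤ sparsity X Np x → relSep X Np x y ≤ A}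

/-- C is LM-separable: A^ℓ(C) < min over distinct clusters c, c' and z ∈ X_c* of A(z,c'). -/
def LMSeparable [MetricSpace α] (X : Finset α) (Np : ℕ) (C : Finset (Finset α)) : Prop :=
  ∀ c ∈ C, ∀ c' ∈ C, c ≠ c' → ∀ z ∈ minSparsityPts X Np c,
    Aell X Np C < relSepCluster X Np z c'

/-- min over x ∈ c of ε_{N_p}(x). -/
noncomputable def minSpars [MetricSpace α] (X : Finset α) (Np : ℕ) (c : Finset α) : ℝ :=
  sInf (sparsity X Np '' (c : Set α))

/-- max over x ∈ c of ε_{N_p}(x). -/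
noncomputable def maxSpars [MetricSpace α] (X : Finset α) (Np : ℕ) (c : Finset α) : ℝ :=
  sSup (sparsity X Np '' (c : Set α))

/-- C is strongly separable: there is an A such that each cluster c is
(A · min sparsity of c)-connected and A · min sparsity of c < min over c' ≠ c of ε(c,c'). -/
def StronglySeparable [MetricSpace α] (X : Finset α) (Np : ℕ)
    (C : Finset (Finset α)) : Prop :=
  ∃ A : ℝ, ∀ c ∈ C, SetConn X Np (A * minSpars X Np c) c ∧
    ∀ c' ∈ C, c' ≠ c → A * minSpars X Np c < clusterDist X Np c c'

/-- c*(x,ε): the set of points of X that are ε-connected to x. -/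
def epsClusterAt [MetricSpace α] (X : Finset α) (Np : ℕ) (ε : ℝ) (x : α) : Set α :=
  {y | EpsConn X Np ε x y}

section General

variable [MetricSpace α] {X : Finset α} {Np : ℕ} {ε δ : ℝ} {x y z : α}

theorem sparsity_two_eq_dist (hx : x ∈ X) (hy : y ∈ X) (hxy : x ≠ y)
    (h : ∀ z ∈ X, z ≠ x → dist x y ≤ dist x z) : sparsity X 2 x = dist x y := by
  classical
  refine IsLeast.csInf_eq ⟨⟨dist_nonneg, ?_⟩, ?_⟩
  · rw [← Finset.card_pair hxy]
    refine Finset.card_le_card fun z hz => ?_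
    rcases Finset.mem_insert.1 hz with rfl | hz
    · simp [hx]
    · rw [Finset.mem_singleton.1 hz]
      simp [hy]
  · rintro ε ⟨-, hε⟩
    obtain ⟨a, ha, b, hb, hab⟩ := Finset.one_lt_card.1 hε
    rw [Finset.mem_filter] at ha hb
    by_cases hax : a = x
    · exact (h b hb.1 fun hbx => hab (hax.trans hbx.symm)).trans hb.2
    · exact (h a ha.1 hax).trans ha.2

namespace EpsConn

theorem refl (hx : x ∈ X) (h : sparsity X Np x ≤ ε) : EpsConn X Np ε x x :=
  ⟨hx, h, .refl⟩

theorem single (hx : x ∈ X) (hy : y ∈ X) (hsx : sparsity X Np x ≤ ε)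
    (hsy : sparsity X Np y ≤ ε) (hd : dist x y ≤ ε) : EpsConn X Np ε x y :=
  ⟨hx, hsx, .single ⟨hy, hsy, hd⟩⟩

theorem trans (h₁ : EpsConn X Np ε x y) (h₂ : EpsConn X Np ε y z) : EpsConn X Np ε x z :=
  ⟨h₁.1, h₁.2.1, h₁.2.2.trans h₂.2.2⟩

theorem symm (h : EpsConn X Np ε x y) : EpsConn X Np ε y x := by
  obtain ⟨hx, hs, h⟩ := h
  suffices y ∈ X ∧ sparsity X Np y ≤ ε ∧ EpsConn X Np ε y x from this.2.2
  induction h with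
  | refl => exact ⟨hx, hs, refl hx hs⟩
  | tail _ hbc ih =>
    exact ⟨hbc.1, hbc.2.1,
      (single hbc.1 ih.1 hbc.2.1 ih.2.1 (by rw [dist_comm]; exact hbc.2.2)).trans ih.2.2⟩

theorem mono (hεδ : ε ≤ δ) (h : EpsConn X Np ε x y) : EpsConn X Np δ x y :=
  ⟨h.1, h.2.1.trans hεδ,
    Relation.ReflTransGen.mono
      (fun _ _ hab => ⟨hab.1, hab.2.1.trans hεδ, hab.2.2.trans hεδ⟩) _ _ h.2.2⟩

/-- A connecting chain cannot cross a cut of `X` whose sides are at distance at least `δ`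
unless `δ ≤ ε`. -/
theorem le_of_cut {P : α → Prop} (hP : ∀ a ∈ X, ∀ b ∈ X, P a → ¬ P b → δ ≤ dist a b)
    (h : EpsConn X Np ε x y) (hx : P x) (hy : ¬ P y) : δ ≤ ε := by
  by_contra! hlt
  obtain ⟨hxX, -, h⟩ := h
  suffices y ∈ X ∧ P y from hy this.2
  clear hy
  induction h with
  | refl => exact ⟨hxX, hx⟩
  | tail _ hbc ih =>
    refine ⟨hbc.1, ?_⟩
    by_contra hc
    linarith [hP _ ih.1 _ hbc.1 ih.2 hc, hbc.2.2]

theorem epsDist_le (h : EpsConn X Np ε x y) : epsDist X Np x y ≤ ε :=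
  csInf_le ⟨sparsity X Np x, fun _ hδ => hδ.2.1⟩ h

theorem le_epsDist (h : EpsConn X Np ε x y) (hδ : ∀ ε, EpsConn X Np ε x y → δ ≤ ε) :
    δ ≤ epsDist X Np x y :=
  le_csInf ⟨ε, h⟩ hδ

end EpsConn

theorem SetConn.of_base {c : Finset α} (h : ∀ y ∈ c, EpsConn X Np ε x y) :
    SetConn X Np ε c :=
  fun a ha b hb => (h a ha).symm.trans (h b hb)

theorem SetConn.setSparsity_le {c : Finset α} (hc : c.Nonempty) (h : SetConn X Np ε c) :
    setSparsity X Np c ≤ ε := by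
  obtain ⟨x, hx⟩ := hc
  exact csInf_le ⟨sparsity X Np x, fun _ hδ => (hδ x hx x hx).2.1⟩ h

theorem le_clusterDist {c c' : Finset α} (hc : c.Nonempty) (hc' : c'.Nonempty)
    (h : ∀ x ∈ c, ∀ y ∈ c', δ ≤ epsDist X Np x y) : δ ≤ clusterDist X Np c c' := by
  obtain ⟨x, hx⟩ := hc
  obtain ⟨y, hy⟩ := hc'
  refine le_csInf ⟨_, x, hx, y, hy, rfl⟩ ?_
  rintro _ ⟨a, ha, b, hb, rfl⟩
  exact h a ha b hb

theorem clusterDist_le {c c' : Finset α} (hx : x ∈ c) (hy : y ∈ c')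
    (h : ∀ x ∈ c, ∀ y ∈ c', δ ≤ epsDist X Np x y) :
    clusterDist X Np c c' ≤ epsDist X Np x y := by
  refine csInf_le ⟨δ, ?_⟩ ⟨x, hx, y, hy, rfl⟩
  rintro _ ⟨a, ha, b, hb, rfl⟩
  exact h a ha b hb

theorem minSpars_eq {c : Finset α} (hx : x ∈ c)
    (h : ∀ y ∈ c, sparsity X Np x ≤ sparsity X Np y) :
    minSpars X Np c = sparsity X Np x := by
  refine IsLeast.csInf_eq ⟨⟨x, hx, rfl⟩, ?_⟩
  rintro _ ⟨y, hy, rfl⟩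
  exact h y hy

end General

namespace SevenPoints

/-- The point set of the example. -/
noncomputable abbrev pts : Finset ℝ := {7, 8, 10, 13, 17, 19, 21}

/-- The left cluster. -/
noncomputable abbrev left : Finset ℝ := {7, 8, 10, 13}

/-- The right cluster. -/
noncomputable abbrev right : Finset ℝ := {17, 19, 21}

theorem sparsity_7 : sparsity pts 2 7 = 1 := by
  rw [sparsity_two_eq_dist (y := 8)] <;> norm_num [Real.dist_eq, abs_of_nonneg, abs_of_neg]

theorem sparsity_8 : sparsity pts 2 8 = 1 := by
  rw [sparsity_two_eq_dist (y := 7)] <;> norm_num [Real.dist_eq, abs_of_nonneg, abs_of_neg]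

theorem sparsity_10 : sparsity pts 2 10 = 2 := by
  rw [sparsity_two_eq_dist (y := 8)] <;> norm_num [Real.dist_eq, abs_of_nonneg, abs_of_neg]

theorem sparsity_13 : sparsity pts 2 13 = 3 := by
  rw [sparsity_two_eq_dist (y := 10)] <;> norm_num [Real.dist_eq, abs_of_nonneg, abs_of_neg]

theorem sparsity_17 : sparsity pts 2 17 = 2 := by
  rw [sparsity_two_eq_dist (y := 19)] <;> norm_num [Real.dist_eq, abs_of_nonneg, abs_of_neg]

theorem sparsity_19 : sparsity pts 2 19 = 2 := by
  rw [sparsity_two_eq_dist (y := 21)] <;> norm_num [Real.dist_eq, abs_of_nonneg, abs_of_neg]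

theorem sparsity_21 : sparsity pts 2 21 = 2 := by
  rw [sparsity_two_eq_dist (y := 19)] <;> norm_num [Real.dist_eq, abs_of_nonneg, abs_of_neg]

theorem epsConn_7_8 : EpsConn pts 2 1 7 8 := by
  apply EpsConn.single <;> norm_num [sparsity_7, sparsity_8, Real.dist_eq]

theorem epsConn_8_10 : EpsConn pts 2 2 8 10 := by
  apply EpsConn.single <;> norm_num [sparsity_10, sparsity_8, Real.dist_eq]

theorem epsConn_10_13 : EpsConn pts 2 3 10 13 := by
  apply EpsConn.single <;> norm_num [sparsity_10, sparsity_13, Real.dist_eq]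

theorem epsConn_13_17 : EpsConn pts 2 4 13 17 := by
  apply EpsConn.single <;> norm_num [sparsity_17, sparsity_13, Real.dist_eq]

theorem epsConn_17_19 : EpsConn pts 2 2 17 19 := by
  apply EpsConn.single <;> norm_num [sparsity_17, sparsity_19, Real.dist_eq]

theorem epsConn_19_21 : EpsConn pts 2 2 19 21 := by
  apply EpsConn.single <;> norm_num [sparsity_21, sparsity_19, Real.dist_eq]

theorem setConn_left : SetConn pts 2 3 left := by
  have h8 := epsConn_7_8.mono (δ := 3) (by norm_num)
  have h10 := h8.trans (epsConn_8_10.mono (by norm_num))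
  refine SetConn.of_base (x := 7) ?_
  simp only [left, Finset.forall_mem_insert, Finset.mem_singleton, forall_eq]
  exact ⟨h8.trans h8.symm, h8, h10, h10.trans epsConn_10_13⟩

theorem setConn_right : SetConn pts 2 2 right := by
  refine SetConn.of_base (x := 17) ?_
  simp only [right, Finset.forall_mem_insert, Finset.mem_singleton, forall_eq]
  exact ⟨epsConn_17_19.trans epsConn_17_19.symm, epsConn_17_19,
    epsConn_17_19.trans epsConn_19_21⟩

theorem epsConn_left_right {x y : ℝ} (hx : x ∈ left) (hy : y ∈ right) :
    EpsConn pts 2 4 x y :=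
  (((setConn_left x hx 13 (by simp)).mono (by norm_num)).trans epsConn_13_17).trans
    ((setConn_right 17 (by simp) y hy).mono (by norm_num))

theorem le_of_epsConn_left_right {x y ε : ℝ} (hx : x ∈ left) (hy : y ∈ right)
    (h : EpsConn pts 2 ε x y) : 4 ≤ ε := by
  refine h.le_of_cut (P := fun a => a < 15) ?_ ?_ ?_
  · norm_num [Real.dist_eq, abs_of_nonneg, abs_of_neg]
  · simp only [left, Finset.mem_insert, Finset.mem_singleton] at hx
    rcases hx with rfl | rfl | rfl | rfl <;> norm_num
  · simp only [right, Finset.mem_insert, Finset.mem_singleton] at hy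
    rcases hy with rfl | rfl | rfl <;> norm_num

theorem epsDist_left_right {x y : ℝ} (hx : x ∈ left) (hy : y ∈ right) :
    epsDist pts 2 x y = 4 :=
  le_antisymm (epsConn_left_right hx hy).epsDist_le
    ((epsConn_left_right hx hy).le_epsDist fun _ => le_of_epsConn_left_right hx hy)

theorem epsDist_right_left {x y : ℝ} (hx : x ∈ right) (hy : y ∈ left) :
    epsDist pts 2 x y = 4 :=
  le_antisymm (epsConn_left_right hy hx).symm.epsDist_le
    ((epsConn_left_right hy hx).symm.le_epsDist fun _ h =>
      le_of_epsConn_left_right hy hx h.symm)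

theorem weaklySeparable : WeaklySeparable pts 2 {left, right} := by
  intro c hc c' hc' hne
  simp only [Finset.mem_insert, Finset.mem_singleton] at hc hc'
  rcases hc with rfl | rfl <;> rcases hc' with rfl | rfl
  · exact absurd rfl hne
  · have h₁ := setConn_left.setSparsity_le (by simp)
    have h₂ : 4 ≤ clusterDist pts 2 left right :=
      le_clusterDist (by simp) (by simp) fun x hx y hy => (epsDist_left_right hx hy).ge
    linarith
  · have h₁ := setConn_right.setSparsity_le (by simp)
    have h₂ : 4 ≤ clusterDist pts 2 right left :=
      le_clusterDist (by simp) (by simp) fun x hx y hy => (epsDist_right_left hx hy).ge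
    linarith
  · exact absurd rfl hne

theorem not_isLocalMaxPt_10 : ¬ IsLocalMaxPt pts 2 10 := fun h => by
  have := h.2 8 (by simp) (by norm_num [sparsity_10, Real.dist_eq])
  norm_num [sparsity_10, sparsity_8] at this

theorem not_isLocalMaxPt_13 : ¬ IsLocalMaxPt pts 2 13 := fun h => by
  have := h.2 10 (by simp) (by norm_num [sparsity_13, Real.dist_eq])
  norm_num [sparsity_13, sparsity_10] at this

theorem isLocalMaxPt_7 : IsLocalMaxPt pts 2 7 := by
  norm_num [IsLocalMaxPt, sparsity_7, sparsity_8, sparsity_10, sparsity_13, sparsity_17,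
    sparsity_19, sparsity_21]

theorem epsDist_le_of_isLocalMaxPt_left {x y : ℝ} (hx : IsLocalMaxPt pts 2 x)
    (hxl : x ∈ left) (hyl : y ∈ left) (hyx : sparsity pts 2 y ≤ sparsity pts 2 x) :
    epsDist pts 2 x y ≤ sparsity pts 2 x := by
  have h := epsConn_7_8
  simp only [left, Finset.mem_insert, Finset.mem_singleton] at hxl hyl
  rcases hxl with rfl | rfl | rfl | rfl
  · rcases hyl with rfl | rfl | rfl | rfl
    · exact (h.trans h.symm).epsDist_le.trans sparsity_7.ge
    · exact h.epsDist_le.trans sparsity_7.ge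
    · norm_num [sparsity_10, sparsity_7] at hyx
    · norm_num [sparsity_13, sparsity_7] at hyx
  · rcases hyl with rfl | rfl | rfl | rfl
    · exact h.symm.epsDist_le.trans sparsity_8.ge
    · exact (h.symm.trans h).epsDist_le.trans sparsity_8.ge
    · norm_num [sparsity_10, sparsity_8] at hyx
    · norm_num [sparsity_13, sparsity_8] at hyx
  · exact absurd hx not_isLocalMaxPt_10
  · exact absurd hx not_isLocalMaxPt_13

theorem sparsity_right {x : ℝ} (hx : x ∈ right) : sparsity pts 2 x = 2 := by
  simp only [right, Finset.mem_insert, Finset.mem_singleton] at hx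
  rcases hx with rfl | rfl | rfl
  exacts [sparsity_17, sparsity_19, sparsity_21]

theorem one_le_sparsity {x : ℝ} (hx : x ∈ pts) : 1 ≤ sparsity pts 2 x := by
  simp only [pts, Finset.mem_insert, Finset.mem_singleton] at hx
  rcases hx with rfl | rfl | rfl | rfl | rfl | rfl | rfl <;>
    norm_num [sparsity_7, sparsity_8, sparsity_10, sparsity_13, sparsity_17,
      sparsity_19, sparsity_21]

theorem aell_le_one : Aell pts 2 {left, right} ≤ 1 := by
  refine csInf_le ⟨relSep pts 2 7 7, fun A hA => hA 7 (by simp) isLocalMaxPt_7 left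
    (by simp) (by simp) 7 (by simp) le_rfl⟩ ?_
  intro x hxX hx c hc hxc y hyc hyx
  refine div_le_one_of_le₀ ?_ (zero_le_one.trans (one_le_sparsity hxX))
  simp only [Finset.mem_insert, Finset.mem_singleton] at hc
  rcases hc with rfl | rfl
  · exact epsDist_le_of_isLocalMaxPt_left hx hxc hyc hyx
  · exact (setConn_right x hxc y hyc).epsDist_le.trans (sparsity_right hxc).ge

theorem two_le_relSepCluster {z : ℝ} {c : Finset ℝ} (hc : c.Nonempty) (hz : z ∈ pts)
    (hs : sparsity pts 2 z ≤ 2) (h : ∀ y ∈ c, epsDist pts 2 z y = 4) :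
    2 ≤ relSepCluster pts 2 z c := by
  obtain ⟨y, hy⟩ := hc
  refine le_csInf ⟨_, y, hy, rfl⟩ ?_
  rintro _ ⟨y, hy, rfl⟩
  have := one_le_sparsity hz
  rw [relSep, h y hy, le_div_iff₀ (by linarith)]
  linarith

theorem lmSeparable : LMSeparable pts 2 {left, right} := by
  intro c hc c' hc' hne z hz
  refine (aell_le_one.trans_lt one_lt_two).trans_le ?_
  obtain ⟨hzc, hmin⟩ := Finset.mem_filter.1 hz
  simp only [Finset.mem_insert, Finset.mem_singleton] at hc hc'
  rcases hc with rfl | rfl <;> rcases hc' with rfl | rfl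
  · exact absurd rfl hne
  · refine two_le_relSepCluster (by simp) ?_ ?_ fun y hy => epsDist_left_right hzc hy
    · exact (setConn_left z hzc z hzc).1
    · linarith [hmin 7 (by simp), sparsity_7]
  · exact two_le_relSepCluster (by simp) (setConn_right z hzc z hzc).1
      (sparsity_right hzc).le fun y hy => epsDist_right_left hzc hy
  · exact absurd rfl hne

theorem not_stronglySeparable : ¬ StronglySeparable pts 2 {left, right} := by
  rintro ⟨A, hA⟩
  have hl : minSpars pts 2 left = 1 := by
    rw [minSpars_eq (x := 7) (by simp), sparsity_7]
    intro y hy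
    rw [sparsity_7]
    exact one_le_sparsity (setConn_left y hy y hy).1
  have hr : minSpars pts 2 right = 2 := by
    rw [minSpars_eq (x := 17) (by simp), sparsity_17]
    intro y hy
    rw [sparsity_17, sparsity_right hy]
  have h₁ := ((hA left (by simp)).1 13 (by simp) 7 (by simp)).2.1
  have hne : left ≠ right := fun h => by
    have : (7 : ℝ) ∈ right := h ▸ (by simp : (7 : ℝ) ∈ left)
    norm_num at this
  have h₂ := (hA right (by simp)).2 left (by simp) hne
  have h₃ : clusterDist pts 2 right left ≤ epsDist pts 2 17 13 :=
    clusterDist_le (by simp) (by simp) fun x hx y hy => (epsDist_right_left hx hy).ge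
  rw [epsDist_right_left (by simp) (by simp)] at h₃
  rw [hl, sparsity_13] at h₁
  rw [hr] at h₂
  linarith

end SevenPoints

/-- the 2-clustering {{7,8,10,13},{17,19,21}} of X = {7,8,10,13,17,19,21} ⊂ ℝ
is weakly separable and LM-separable but not strongly separable for N_p = 2. -/
theorem stmt_14 :
    WeaklySeparable ({7, 8, 10, 13, 17, 19, 21} : Finset ℝ) 2
      ({({7, 8, 10, 13} : Finset ℝ), ({17, 19, 21} : Finset ℝ)} : Finset (Finset ℝ)) ∧
    LMSeparable ({7, 8, 10, 13, 17, 19, 21} : Finset ℝ) 2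
      ({({7, 8, 10, 13} : Finset ℝ), ({17, 19, 21} : Finset ℝ)} : Finset (Finset ℝ)) ∧
    ¬ StronglySeparable ({7, 8, 10, 13, 17, 19, 21} : Finset ℝ) 2
      ({({7, 8, 10, 13} : Finset ℝ), ({17, 19, 21} : Finset ℝ)} : Finset (Finset ℝ)) := by
  exact ⟨SevenPoints.weaklySeparable, SevenPoints.lmSeparable,
    SevenPoints.not_stronglySeparable⟩
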